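/- (A naturally reductive homogeneous quaternionic Kähler structure is symmetric.) For n ≥ 2, if S ∈ 𝒱 is totally skew-symmetric, i.e. S_{XYZ} = −S_{YXZ} for all X, Y, Z ∈ V (in addition to S_{XYZ} = −S_{XZY}), then S = 0; equivalently, 𝒱 contains no nonzero 3-form. -/

import Mathlib

open scoped RealInnerProductSpace

noncomputable section

/-- Trilinear forms on `V`. -/
abbrev Tri (V : Type) [NormedAddCommGroup V] [InnerProductSpace ℝ V] : Type :=
  V →ₗ[ℝ] V →ₗ[ℝ] V →ₗ[ℝ] ℝ

variable {V : Type} [NormedAddCommGroup V] [InnerProductSpace ℝ V]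

/-- `(V, ⟨·,·⟩, J₁, J₂, J₃)` is a quaternion-Hermitian vector space: the `Jₐ` square to `-1`,
satisfy the quaternion relations, and are isometries. -/
def IsQH (J1 J2 J3 : V →ₗ[ℝ] V) : Prop :=
  (∀ X, J1 (J1 X) = -X) ∧ (∀ X, J2 (J2 X) = -X) ∧ (∀ X, J3 (J3 X) = -X) ∧
  (∀ X, J1 (J2 X) = J3 X) ∧ (∀ X, J2 (J1 X) = -(J3 X)) ∧
  (∀ X, J2 (J3 X) = J1 X) ∧ (∀ X, J3 (J2 X) = -(J1 X)) ∧
  (∀ X, J3 (J1 X) = J2 X) ∧ (∀ X, J1 (J3 X) = -(J2 X)) ∧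
  (∀ X Y, ⟪J1 X, J1 Y⟫ = ⟪X, Y⟫) ∧ (∀ X Y, ⟪J2 X, J2 Y⟫ = ⟪X, Y⟫) ∧
  (∀ X Y, ⟪J3 X, J3 Y⟫ = ⟪X, Y⟫)

/-- The space `𝒯(V)` of trilinear forms skew in the last two arguments. -/
def calT : Set (Tri V) := {S | ∀ X Y Z, S X Y Z = - S X Z Y}

/-- The space `𝒱` of (pointwise) homogeneous quaternionic Kähler structures. -/
def calV (J1 J2 J3 : V →ₗ[ℝ] V) : Set (Tri V) :=
  {S | (∀ X Y Z, S X Y Z = - S X Z Y) ∧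
    ∃ π1 π2 π3 : V →ₗ[ℝ] ℝ, ∀ X Y Z : V,
      (S X (J1 Y) (J1 Z) - S X Y Z
        = π3 X * ⟪J2 Y, J1 Z⟫ - π2 X * ⟪J3 Y, J1 Z⟫) ∧
      (S X (J2 Y) (J2 Z) - S X Y Z
        = π1 X * ⟪J3 Y, J2 Z⟫ - π3 X * ⟪J1 Y, J2 Z⟫) ∧
      (S X (J3 Y) (J3 Z) - S X Y Z
        = π2 X * ⟪J1 Y, J3 Z⟫ - π1 X * ⟪J2 Y, J3 Z⟫)}

/-- The space `𝒱̌`. -/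
def calVcheck (J1 J2 J3 : V →ₗ[ℝ] V) : Set (Tri V) :=
  {Θ | ∃ π1 π2 π3 : V →ₗ[ℝ] ℝ, ∀ X Y Z : V,
    Θ X Y Z = (1/2) * (π1 X * ⟪J1 Y, Z⟫ + π2 X * ⟪J2 Y, Z⟫ + π3 X * ⟪J3 Y, Z⟫)}

/-- The space `𝒱̂`. -/
def calVhat (J1 J2 J3 : V →ₗ[ℝ] V) : Set (Tri V) :=
  {T | (∀ X Y Z, T X Y Z = - T X Z Y) ∧
    (∀ X Y Z, T X (J1 Y) (J1 Z) = T X Y Z) ∧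
    (∀ X Y Z, T X (J2 Y) (J2 Z) = T X Y Z) ∧
    (∀ X Y Z, T X (J3 Y) (J3 Z) = T X Y Z)}

/-- Inner product of trilinear forms w.r.t. an orthonormal basis. -/
def tinner {n : ℕ} (e : OrthonormalBasis (Fin (4*n)) ℝ V) (S S' : Tri V) : ℝ :=
  ∑ r, ∑ s, ∑ t, S (e r) (e s) (e t) * S' (e r) (e s) (e t)

/-- The trace `c₁₂` of a trilinear form w.r.t. an orthonormal basis. -/
def c12 {n : ℕ} (e : OrthonormalBasis (Fin (4*n)) ℝ V) (S : Tri V) (Z : V) : ℝ :=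
  ∑ r, S (e r) (e r) Z

/-- `A` is an `Sp(n)Sp(1)`-transformation: an orthogonal map with
`A ∘ Jₐ = Σ_b mₐᵇ J_b ∘ A` for some `m ∈ SO(3)`. -/
def IsSpnSp1 (J1 J2 J3 : V →ₗ[ℝ] V) (A : V ≃ₗᵢ[ℝ] V) : Prop :=
  ∃ m : Matrix (Fin 3) (Fin 3) ℝ, m.transpose * m = 1 ∧ m.det = 1 ∧
    (∀ X, A (J1 X) = m 0 0 • J1 (A X) + m 0 1 • J2 (A X) + m 0 2 • J3 (A X)) ∧
    (∀ X, A (J2 X) = m 1 0 • J1 (A X) + m 1 1 • J2 (A X) + m 1 2 • J3 (A X)) ∧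
    (∀ X, A (J3 X) = m 2 0 • J1 (A X) + m 2 1 • J2 (A X) + m 2 2 • J3 (A X))

/-- Action of an isometry on trilinear forms: `(A(S))_{XYZ} = S_{A⁻¹X,A⁻¹Y,A⁻¹Z}`. -/
def act (A : V ≃ₗᵢ[ℝ] V) (S : Tri V) : Tri V :=
  ((S.comp A.symm.toLinearMap).compl₂ A.symm.toLinearMap).compr₂
    (LinearMap.lcomp ℝ ℝ A.symm.toLinearMap)

@[simp] theorem act_apply (A : V ≃ₗᵢ[ℝ] V) (S : Tri V) (X Y Z : V) :
    act A S X Y Z = S (A.symm X) (A.symm Y) (A.symm Z) := rfl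

/-- `(X,Y,Z) ↦ T(Z,X,Y)` as a trilinear form. -/
def cyc1 (T : Tri V) : Tri V := LinearMap.lflip.comp T.flip

@[simp] theorem cyc1_apply (T : Tri V) (X Y Z : V) : cyc1 T X Y Z = T Z X Y := rfl

/-- `(X,Y,Z) ↦ T(Y,Z,X)` as a trilinear form. -/
def cyc2 (T : Tri V) : Tri V := (LinearMap.lflip.comp T).flip

@[simp] theorem cyc2_apply (T : Tri V) (X Y Z : V) : cyc2 T X Y Z = T Y Z X := rfl

/-- Precompose the second and third arguments of a trilinear form with `f`. -/
def precomp23 (T : Tri V) (f : V →ₗ[ℝ] V) : Tri V :=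
  (T.compl₂ f).compr₂ (LinearMap.lcomp ℝ ℝ f)

@[simp] theorem precomp23_apply (T : Tri V) (f : V →ₗ[ℝ] V) (X Y Z : V) :
    precomp23 T f X Y Z = T X (f Y) (f Z) := rfl

/-- The operator `L` on trilinear forms:
`L(T)_{XYZ} = T_{ZXY} + T_{YZX} + Σₐ (T_{JₐZ,X,JₐY} + T_{JₐY,JₐZ,X})`. -/
def Lmap (J1 J2 J3 : V →ₗ[ℝ] V) (T : Tri V) : Tri V :=
  cyc1 T + cyc2 T
    + precomp23 (cyc1 T) J1 + precomp23 (cyc1 T) J2 + precomp23 (cyc1 T) J3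
    + precomp23 (cyc2 T) J1 + precomp23 (cyc2 T) J2 + precomp23 (cyc2 T) J3

theorem Lmap_apply (J1 J2 J3 : V →ₗ[ℝ] V) (T : Tri V) (X Y Z : V) :
    Lmap J1 J2 J3 T X Y Z
      = T Z X Y + T Y Z X
        + (T (J1 Z) X (J1 Y) + T (J1 Y) (J1 Z) X)
        + (T (J2 Z) X (J2 Y) + T (J2 Y) (J2 Z) X)
        + (T (J3 Z) X (J3 Y) + T (J3 Y) (J3 Z) X) := by
  simp [Lmap]; ring

/-- The space `𝒱̌₀^⊥ = 𝒬𝒦₁`. -/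
def calVcheck0perp (J1 J2 J3 : V →ₗ[ℝ] V) : Set (Tri V) :=
  {Θ | ∃ θ : V →ₗ[ℝ] ℝ, ∀ X Y Z : V,
    Θ X Y Z = θ (J1 X) * ⟪J1 Y, Z⟫ + θ (J2 X) * ⟪J2 Y, Z⟫ + θ (J3 X) * ⟪J3 Y, Z⟫}

/-- The space `𝒱̌₀ = 𝒬𝒦₂`. -/
def calVcheck0 (J1 J2 J3 : V →ₗ[ℝ] V) : Set (Tri V) :=
  {Θ | ∃ π1 π2 π3 : V →ₗ[ℝ] ℝ,
    (∀ X Y Z : V, Θ X Y Z = π1 X * ⟪J1 Y, Z⟫ + π2 X * ⟪J2 Y, Z⟫ + π3 X * ⟪J3 Y, Z⟫) ∧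
    (∀ X : V, π1 (J1 X) + π2 (J2 X) + π3 (J3 X) = 0)}

/-- The values of the tensor `T^θ`. -/
def TthetaForm (J1 J2 J3 : V →ₗ[ℝ] V) (θ : V →ₗ[ℝ] ℝ) (X Y Z : V) : ℝ :=
  ⟪X, Y⟫ * θ Z - ⟪X, Z⟫ * θ Y
    + (⟪X, J1 Y⟫ * θ (J1 Z) - ⟪X, J1 Z⟫ * θ (J1 Y))
    + (⟪X, J2 Y⟫ * θ (J2 Z) - ⟪X, J2 Z⟫ * θ (J2 Y))
    + (⟪X, J3 Y⟫ * θ (J3 Z) - ⟪X, J3 Z⟫ * θ (J3 Y))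

/-- The space `𝒱̂₀^⊥ = 𝒬𝒦₃ = {T^θ : θ ∈ V*}`. -/
def TthetaSet (J1 J2 J3 : V →ₗ[ℝ] V) : Set (Tri V) :=
  {T | ∃ θ : V →ₗ[ℝ] ℝ, ∀ X Y Z : V, T X Y Z = TthetaForm J1 J2 J3 θ X Y Z}

/-- The space `𝒬𝒦₄`. -/
def QK4set (J1 J2 J3 : V →ₗ[ℝ] V) {n : ℕ} (e : OrthonormalBasis (Fin (4*n)) ℝ V) :
    Set (Tri V) :=
  {T | T ∈ calVhat J1 J2 J3 ∧
    (∀ X Y Z : V, T X Y Z = (1/6) * ((T X Y Z + T Y Z X + T Z X Y)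
      + (T X (J1 Y) (J1 Z) + T (J1 Y) (J1 Z) X + T (J1 Z) X (J1 Y))
      + (T X (J2 Y) (J2 Z) + T (J2 Y) (J2 Z) X + T (J2 Z) X (J2 Y))
      + (T X (J3 Y) (J3 Z) + T (J3 Y) (J3 Z) X + T (J3 Z) X (J3 Y)))) ∧
    (∀ Z, c12 e T Z = 0)}

/-- The space `𝒬𝒦₅`. -/
def QK5set (J1 J2 J3 : V →ₗ[ℝ] V) : Set (Tri V) :=
  {T | T ∈ calVhat J1 J2 J3 ∧ ∀ X Y Z : V, T X Y Z + T Y Z X + T Z X Y = 0}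

theorem IsQH.rotate {J1 J2 J3 : V →ₗ[ℝ] V} (h : IsQH J1 J2 J3) : IsQH J2 J3 J1 := by
  obtain ⟨h11, h22, h33, h12, h21, h23, h32, h31, h13, i1, i2, i3⟩ := h
  exact ⟨h22, h33, h11, h23, h32, h31, h13, h12, h21, i2, i3, i1⟩

theorem inner_map_right_eq_neg {J : V →ₗ[ℝ] V} (hJ : ∀ X, J (J X) = -X)
    (hi : ∀ X Y, ⟪J X, J Y⟫ = ⟪X, Y⟫) (X Y : V) : ⟪X, J Y⟫ = -⟪J X, Y⟫ := by
  rw [← hi X (J Y), hJ, inner_neg_right]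

theorem inner_map_self_eq_zero_of_isometry {J : V →ₗ[ℝ] V} (hJ : ∀ X, J (J X) = -X)
    (hi : ∀ X Y, ⟪J X, J Y⟫ = ⟪X, Y⟫) (X : V) : ⟪J X, X⟫ = 0 := by
  have h := inner_map_right_eq_neg hJ hi X X
  rw [real_inner_comm] at h
  linarith

/-- A `3`-form is determined by the defect of its invariance under a complex structure. -/
theorem two_mul_eq_of_defect {J : V →ₗ[ℝ] V} (hJ : ∀ X, J (J X) = -X) {S : Tri V}
    (hT : ∀ X Y Z, S X Y Z = -S X Z Y) (hskew : ∀ X Y Z, S X Y Z = -S Y X Z)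
    {D : V → V → V → ℝ} (h : ∀ X Y Z, S X (J Y) (J Z) - S X Y Z = D X Y Z) (X Y Z : V) :
    2 * S X Y Z = -D (J X) Y (J Z) - D Y Z X - D Z X Y := by
  have h1 := h (J X) Y (J Z)
  have h2 := h Y Z X
  have h3 := h Z X Y
  have c1 : ∀ X Y Z, S X Y Z = S Y Z X := fun X Y Z => by rw [hskew, hT, neg_neg]
  rw [hJ, map_neg] at h1
  rw [← c1 (J X) Y (J Z), ← c1 X Y Z] at h2
  rw [c1 Z (J X) (J Y), c1 Z X Y] at h3
  linarith

/-- In dimension greater than `4`, the vectors `X, J1 X, J2 X, J3 X` have a common nonzero normal. -/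
theorem exists_ne_zero_inner_eq_zero (J1 J2 J3 : V →ₗ[ℝ] V)
    (hdim : 4 < Module.finrank ℝ V) (X : V) :
    ∃ Y : V, Y ≠ 0 ∧ ⟪X, Y⟫ = 0 ∧ ⟪J1 X, Y⟫ = 0 ∧ ⟪J2 X, Y⟫ = 0 ∧ ⟪J3 X, Y⟫ = 0 := by
  set v : Fin 4 → V := ![X, J1 X, J2 X, J3 X]
  set K := Submodule.span ℝ (Set.range v)
  have hK4 : Module.finrank ℝ K ≤ 4 := by
    exact (finrank_range_le_card (R := ℝ) v).trans_eq (Fintype.card_fin 4)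
  have : FiniteDimensional ℝ V := FiniteDimensional.of_finrank_pos (by omega)
  have hne : Kᗮ ≠ ⊥ := by
    intro hb
    have ht := (Submodule.orthogonal_eq_bot_iff (K := K)).1 hb
    rw [ht, finrank_top] at hK4
    omega
  obtain ⟨Y, hY, hY0⟩ := Submodule.exists_mem_ne_zero_of_ne_bot hne
  have key : ∀ i, ⟪v i, Y⟫ = 0 := fun i =>
    (Submodule.mem_orthogonal K Y).1 hY _ (Submodule.subset_span ⟨i, rfl⟩)
  exact ⟨Y, hY0, key 0, key 1, key 2, key 3⟩

/-- Comparing the defects of a `3`-form with respect to `J1` and `J2` kills the third `1`-form. -/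
theorem oneForm_eq_zero {J1 J2 J3 : V →ₗ[ℝ] V} (hQH : IsQH J1 J2 J3)
    (hdim : 4 < Module.finrank ℝ V) {S : Tri V}
    (hT : ∀ X Y Z, S X Y Z = -S X Z Y) (hskew : ∀ X Y Z, S X Y Z = -S Y X Z)
    {π1 π2 π3 : V →ₗ[ℝ] ℝ}
    (hJ1 : ∀ X Y Z, S X (J1 Y) (J1 Z) - S X Y Z
      = π3 X * ⟪J2 Y, J1 Z⟫ - π2 X * ⟪J3 Y, J1 Z⟫)
    (hJ2 : ∀ X Y Z, S X (J2 Y) (J2 Z) - S X Y Z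
      = π1 X * ⟪J3 Y, J2 Z⟫ - π3 X * ⟪J1 Y, J2 Z⟫) (X : V) : π3 X = 0 := by
  obtain ⟨h11, h22, h33, h12, h21, h23, h32, h31, h13, i1, i2, i3⟩ := hQH
  obtain ⟨Y, hY, o0, o1, o2, o3⟩ := exists_ne_zero_inner_eq_zero J1 J2 J3 hdim X
  have a1 := inner_map_right_eq_neg h11 i1
  have a2 := inner_map_right_eq_neg h22 i2
  have a3 := inner_map_right_eq_neg h33 i3
  have z1 := inner_map_self_eq_zero_of_isometry h11 i1 Y
  have z2 := inner_map_self_eq_zero_of_isometry h22 i2 Y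
  have z3 := inner_map_self_eq_zero_of_isometry h33 i3 Y
  have p0 : ⟪Y, X⟫ = 0 := by rw [real_inner_comm, o0]
  have p1 : ⟪J1 Y, X⟫ = 0 := by rw [real_inner_comm, a1, o1, neg_zero]
  have p2 : ⟪J2 Y, X⟫ = 0 := by rw [real_inner_comm, a2, o2, neg_zero]
  have p3 : ⟪J3 Y, X⟫ = 0 := by rw [real_inner_comm, a3, o3, neg_zero]
  have hJY : J1 Y ≠ 0 := fun h0 => hY (by simpa [h0] using h11 Y)
  have f1 := two_mul_eq_of_defect h11 hT hskew hJ1 (J2 X) Y (J1 Y)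
  have f2 := two_mul_eq_of_defect h22 hT hskew hJ2 (J2 X) Y (J1 Y)
  rw [f1] at f2
  simpa [a1, a2, a3, h11, h22, h33, h12, h21, h23, h32, h31, h13, o0, o1, o2, o3,
    p0, p1, p2, p3, z1, z2, z3, hJY] using f2

/-- for `n ≥ 2`, `𝒱` contains no nonzero `3`-form: a totally
skew-symmetric element of `𝒱` vanishes. -/
theorem stmt17 (J1 J2 J3 : V →ₗ[ℝ] V) (hQH : IsQH J1 J2 J3)
    {n : ℕ} (hn : 2 ≤ n) (hdim : Module.finrank ℝ V = 4 * n)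
    (S : Tri V) (hS : S ∈ calV J1 J2 J3)
    (hskew : ∀ X Y Z : V, S X Y Z = - S Y X Z) :
    S = 0 := by
  obtain ⟨hT, π1, π2, π3, h⟩ := hS
  have hdim' : 4 < Module.finrank ℝ V := by omega
  have e3 := oneForm_eq_zero hQH hdim' hT hskew
    (fun X Y Z => (h X Y Z).1) (fun X Y Z => (h X Y Z).2.1)
  have e2 := oneForm_eq_zero hQH.rotate.rotate hdim' hT hskew
    (fun X Y Z => (h X Y Z).2.2) (fun X Y Z => (h X Y Z).1)
  ext X Y Z
  have f := two_mul_eq_of_defect hQH.1 hT hskew (fun X Y Z => (h X Y Z).1) X Y Z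
  simpa [e2, e3] using f

end
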